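/- arXiv:2008.05551 — 3 statements merged into one kernel-verified Lean document; each statement's English description precedes it below -/
import Mathlib

section
/- Let p be an odd prime and let G = DihedralGroup p (the dihedral group of order 2p). For every n ≥ 1, the group cohomology H^n(G; ℤ) with coefficients in the trivial G-representation on ℤ is: isomorphic to ZMod (2p) if n ≡ 0 mod 4; the zero module if n is odd; and isomorphic to ZMod 2 if n ≡ 2 mod 4. -/
section

open CategoryTheory Rep

/-- An additive equivalence is linear over `ℤ`, for any `ℤ`-module structures. -/
def AddEquiv.toLinearEquivInt {M N : Type*} [AddCommGroup M] [AddCommGroup N] [Module ℤ M]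
    [Module ℤ N] (e : M ≃+ N) : M ≃ₗ[ℤ] N :=
  e.toLinearEquiv fun c x => by simpa using map_intCast_smul e ℤ ℤ c x

lemma nonempty_addEquiv_zmod {M : Type*} [AddCommGroup M] (m : ℕ) (f : ℤ →+ M)
    (hf : Function.Surjective f) (hker : ∀ z, f z = 0 ↔ (m : ℤ) ∣ z) :
    Nonempty (M ≃+ ZMod m) := by
  have h : f.ker = AddSubgroup.zmultiples (m : ℤ) := by
    ext z
    rw [AddMonoidHom.mem_ker, hker, Int.mem_zmultiples_iff]
  exact ⟨(QuotientAddGroup.quotientKerEquivOfSurjective f hf).symm.trans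
    ((QuotientAddGroup.quotientAddEquivOfEq h).trans (Int.quotientZMultiplesNatEquivZMod m))⟩

lemma isCompl_range_ker_of_rightInverse {R M N : Type*} [Ring R] [AddCommGroup M] [AddCommGroup N]
    [Module R M] [Module R N] (f : M →ₗ[R] N) (g : N →ₗ[R] M) (h : ∀ x, f (g x) = x) :
    IsCompl (LinearMap.range g) (LinearMap.ker f) := by
  refine ⟨Submodule.disjoint_def.2 ?_, codisjoint_iff_le_sup.2 fun x _ => ?_⟩
  · rintro _ ⟨y, rfl⟩ hy
    rw [← h y, LinearMap.mem_ker.1 hy, map_zero]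
  · refine Submodule.mem_sup.2 ⟨g (f x), ⟨_, rfl⟩, x - g (f x), ?_, by abel⟩
    rw [LinearMap.mem_ker, map_sub, h, sub_self]

lemma nonempty_quotient_range_equiv_ker_of_rightInverse {R M N : Type*} [Ring R]
    [AddCommGroup M] [AddCommGroup N] [Module R M] [Module R N] (f : M →ₗ[R] N) (g : N →ₗ[R] M)
    (h : ∀ x, f (g x) = x) : Nonempty ((M ⧸ LinearMap.range g) ≃+ LinearMap.ker f) :=
  ⟨(Submodule.quotientEquivOfIsCompl _ _ (isCompl_range_ker_of_rightInverse f g h)).toAddEquiv⟩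

lemma nonempty_equiv_prod_of_rightInverse {R M N : Type*} [Ring R]
    [AddCommGroup M] [AddCommGroup N] [Module R M] [Module R N] (f : M →ₗ[R] N) (g : N →ₗ[R] M)
    (h : ∀ x, f (g x) = x) : Nonempty (M ≃+ N × LinearMap.ker f) :=
  ⟨((LinearEquiv.prodCongr (LinearEquiv.ofInjective g (Function.LeftInverse.injective h))
    (LinearEquiv.refl R _)).trans (Submodule.prodEquivOfIsCompl _ _
      (isCompl_range_ker_of_rightInverse f g h))).symm.toAddEquiv⟩

lemma exact_of_ker_le_range {k G : Type} [CommRing k] [Group G] {A B C : Rep k G}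
    (f : A ⟶ B) (g : B ⟶ C) (hfg : f ≫ g = 0) (h : ∀ x, g.hom x = 0 → ∃ y, f.hom y = x) :
    (ShortComplex.mk f g hfg).Exact := by
  rw [← ShortComplex.exact_map_iff_of_faithful _ (forget₂ (Rep k G) (ModuleCat k)),
    ShortComplex.moduleCat_exact_iff]
  exact h

namespace groupCohomology

section General

universe u
variable {k G : Type u} [CommRing k] [Group G]

/-- Evaluation at `1`, the counit of the restriction-coinduction adjunction. -/
noncomputable def coindEval (S : Subgroup G) (B : Rep k S) :
    res S.subtype (coind S.subtype B) ⟶ B :=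
  (resCoindHomEquiv.{u} S.subtype (coind S.subtype B) B).symm (𝟙 _)

/-- The unit of the restriction-coinduction adjunction. -/
noncomputable def toCoind (S : Subgroup G) (A : Rep k G) :
    A ⟶ coind S.subtype (res S.subtype A) :=
  resCoindToHom S.subtype A (res S.subtype A) (𝟙 _)

lemma map_toCoind_surjective (S : Subgroup G) (A : Rep k G) (π : G →* S)
    (hπ : π.comp S.subtype = MonoidHom.id S) (hA : ∀ g, A.ρ (π g : G) = A.ρ g) (n : ℕ)
    [IsNoetherian k (groupCohomology (res S.subtype A) n)] :
    Function.Surjective (map (MonoidHom.id G) (toCoind S A) n).hom := by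
  let B := res S.subtype A
  let φ : res π B ⟶ A := Rep.ofHom ⟨LinearMap.id, fun g => by
    ext x
    simp [B, ← hA g]⟩
  let E := map S.subtype (coindEval S B) n
  have h1 : map π φ n ≫ map (MonoidHom.id G) (toCoind S A) n ≫ E = 𝟙 _ := by
    rw [← map_comp, ← map_comp, ← map_id]
    refine map_congr (by simpa using hπ) ?_ n
    ext x
    change A.ρ 1 x = x
    simp
  have h2 : ∀ x, E.hom ((map (MonoidHom.id G) (toCoind S A) n).hom ((map π φ n).hom x)) = x :=
    fun x => congr($(h1).hom x)
  have hE : Function.Injective E.hom := by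
    let e := (coindIso B n).toLinearEquiv
    have hs : Function.Surjective (E.hom ∘ₗ e.symm.toLinearMap) := by
      intro x
      exact ⟨e ((map (MonoidHom.id G) (toCoind S A) n).hom ((map π φ n).hom x)),
        (congrArg E.hom (e.symm_apply_apply _)).trans (h2 x)⟩
    have := IsNoetherian.injective_of_surjective_endomorphism _ hs
    intro x y hxy
    apply e.injective
    apply this
    simpa using hxy
  intro y
  exact ⟨(map π φ n).hom (E.hom y), hE (h2 _)⟩

lemma map_smul_id (A : Rep k G) (c : k) (n : ℕ) :
    map (MonoidHom.id G) (c • 𝟙 A) n = c • 𝟙 _ := by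
  have : cochainsMap (MonoidHom.id G) (c • 𝟙 A) = c • 𝟙 (inhomogeneousCochains A) := by
    ext; rfl
  rw [map, this, HomologicalComplex.homologyMap,
    show (HomologicalComplex.shortComplexFunctor (ModuleCat k) (.up ℕ) n).map
      (c • 𝟙 (inhomogeneousCochains A)) = c • 𝟙 _ from ?_, ShortComplex.homologyMap_smul,
    ShortComplex.homologyMap_id]
  · rfl
  · ext <;> rfl

lemma map_natCast_smul_id_apply (A : Rep k G) (m n : ℕ) (x : groupCohomology A n) :
    (map (MonoidHom.id G) ((m : k) • 𝟙 A) n).hom x = m • x := by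
  rw [map_smul_id, ← Nat.cast_smul_eq_nsmul k]
  rfl

end General
end groupCohomology

namespace Rep.FiniteCyclicGroup

section

universe u
variable {k C : Type u} [CommRing k] [CommGroup C] [Fintype C] (A : Rep k C) (g : C)
  (hg : ∀ x, x ∈ Subgroup.zpowers g)

lemma groupCohomologyπEven_surjective (i : ℕ) [NeZero i] (hi : Even i) :
    Function.Surjective (groupCohomologyπEven A g hg i hi).hom :=
  (ModuleCat.epi_iff_surjective _).1
    (epi_comp' (Iso.isIso_inv (ShortComplex.moduleCatCyclesIso _)).epi_of_iso
      (epi_comp' inferInstance inferInstance))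

lemma groupCohomologyπOdd_surjective (i : ℕ) (hi : Odd i) :
    Function.Surjective (groupCohomologyπOdd A g hg i hi).hom :=
  (ModuleCat.epi_iff_surjective _).1
    (epi_comp' (Iso.isIso_inv (ShortComplex.moduleCatCyclesIso _)).epi_of_iso
      (epi_comp' inferInstance inferInstance))

include hg

lemma isNoetherian_groupCohomology [IsNoetherian k A.V] (i : ℕ) :
    IsNoetherian k (groupCohomology A i) := by
  rcases Nat.eq_zero_or_pos i with rfl | h
  · exact isNoetherian_of_linearEquiv (groupCohomologyIso₀ A g hg).toLinearEquiv.symm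
  · have : NeZero i := ⟨h.ne'⟩
    rcases Nat.even_or_odd i with hi | hi
    · exact isNoetherian_of_surjective (groupCohomologyπEven A g hg i hi).hom
        (LinearMap.range_eq_top.2 (groupCohomologyπEven_surjective A g hg i hi))
    · exact isNoetherian_of_surjective (groupCohomologyπOdd A g hg i hi).hom
        (LinearMap.range_eq_top.2 (groupCohomologyπOdd_surjective A g hg i hi))

lemma ρ_apply_sub_mem_range (h : C) (x : A) :
    A.ρ h x - x ∈ LinearMap.range (applyAsHom A g - 𝟙 A).hom.toLinearMap := by
  set W := LinearMap.range (applyAsHom A g - 𝟙 A).hom.toLinearMap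
  have key : ∀ y, A.ρ g y - y ∈ W := fun y => ⟨y, by simp [sub_hom]⟩
  have hh := hg h
  rw [← mem_powers_iff_mem_zpowers] at hh
  obtain ⟨n, rfl⟩ := hh
  induction n with
  | zero => simp
  | succ n ih =>
    simp only at ih ⊢
    have := W.add_mem (key (A.ρ (g ^ n) x)) ih
    rw [pow_succ', map_mul]
    simpa using this

lemma card_nsmul_eq_zero (i : ℕ) (hi : i ≠ 0) (x : groupCohomology A i) :
    Fintype.card C • x = 0 := by
  have : NeZero i := ⟨hi⟩
  rcases Nat.even_or_odd i with hi | hi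
  · obtain ⟨y, rfl⟩ := groupCohomologyπEven_surjective A g hg i hi x
    rw [← map_nsmul]
    refine (groupCohomologyπEven_eq_zero_iff A g hg i hi _).2 ⟨y.1, ?_⟩
    have hy : A.ρ g y.1 = y.1 := by simpa [sub_hom, sub_eq_zero] using y.2
    have hy' : ∀ h, A.ρ h y.1 = y.1 :=
      (Representation.mem_invariants_iff_of_forall_mem_zpowers A.ρ g hg _).2 hy
    simp [norm_apply, Representation.norm, hy']
  · obtain ⟨y, rfl⟩ := groupCohomologyπOdd_surjective A g hg i hi x
    rw [← map_nsmul]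
    refine (groupCohomologyπOdd_eq_zero_iff A g hg i hi _).2 ?_
    have hy : A.ρ.norm y.1 = 0 := LinearMap.mem_ker.1 y.2
    rw [Representation.norm, LinearMap.sum_apply] at hy
    have := Submodule.sum_mem _ (fun h (_ : h ∈ Finset.univ) => ρ_apply_sub_mem_range A g hg h y.1)
    rw [Finset.sum_sub_distrib, hy, zero_sub, neg_mem_iff] at this
    simpa using this

end

lemma subsingleton_groupCohomology_trivial_int_of_odd (C : Type) [CommGroup C] [Fintype C] (g : C)
    (hg : ∀ x, x ∈ Subgroup.zpowers g) (i : ℕ) (hi : Odd i) :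
    Subsingleton (groupCohomology (trivial ℤ C ℤ) i) := by
  refine subsingleton_of_forall_eq 0 fun x => ?_
  obtain ⟨y, rfl⟩ := groupCohomologyπOdd_surjective _ g hg i hi x
  have hy : (trivial ℤ C ℤ).ρ.norm y.1 = 0 := LinearMap.mem_ker.1 y.2
  have : y = 0 := by
    ext
    simpa [Representation.norm] using hy
  rw [this, map_zero]

lemma groupCohomology_trivial_int_of_even (C : Type) [CommGroup C] [Fintype C] (g : C)
    (hg : ∀ x, x ∈ Subgroup.zpowers g) (i : ℕ) (h0 : i ≠ 0) (hi : Even i) :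
    Nonempty (groupCohomology (trivial ℤ C ℤ) i ≃+ ZMod (Fintype.card C)) := by
  have : NeZero i := ⟨h0⟩
  have hz : ∀ z : ℤ, z ∈ LinearMap.ker (applyAsHom (trivial ℤ C ℤ) g - 𝟙 _).hom.toLinearMap :=
    fun z => sub_self z
  refine nonempty_addEquiv_zmod _ ((groupCohomologyπEven (trivial ℤ C ℤ) g hg i hi).hom ∘ₗ
    LinearMap.id.codRestrict (LinearMap.ker _) hz).toAddMonoidHom ?_ fun z => ?_
  · intro x
    obtain ⟨y, rfl⟩ := groupCohomologyπEven_surjective _ g hg i hi x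
    exact ⟨y.1, rfl⟩
  · refine (groupCohomologyπEven_eq_zero_iff (trivial ℤ C ℤ) g hg i hi _).trans ?_
    have (y : ℤ) : (trivial ℤ C ℤ).norm.hom y = Fintype.card C * y := by
      change (trivial ℤ C ℤ).ρ.norm y = _
      simp [Representation.norm]
    exact exists_congr fun y => (this y) ▸ eq_comm

end Rep.FiniteCyclicGroup

namespace CategoryTheory.ShortComplex

variable {C : Type*} [Category C] [Abelian C] {A X Y B : C} (f : A ⟶ X) (g : X ⟶ Y) (h : Y ⟶ B)
  (hfg : f ≫ g = 0) (hgh : g ≫ h = 0)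

lemma shortExact_cokernel [Mono f] :
    (ShortComplex.mk f (Limits.cokernel.π f) (Limits.cokernel.condition f)).ShortExact where
  exact := ShortComplex.exact_cokernel f

include hgh in
lemma cokernel_desc_comp : Limits.cokernel.desc f g hfg ≫ h = 0 := by
  simp [← cancel_epi (Limits.cokernel.π f), hgh]

lemma shortExact_cokernel_desc (h1 : (ShortComplex.mk f g hfg).Exact)
    (h2 : (ShortComplex.mk g h hgh).Exact) [Epi h] :
    (ShortComplex.mk (Limits.cokernel.desc f g hfg) h
      (cokernel_desc_comp f g h hfg hgh)).ShortExact where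
  mono_f := h1.mono_cokernelDesc
  exact := by
    let φ : ShortComplex.mk g h hgh ⟶ ShortComplex.mk (Limits.cokernel.desc f g hfg) h
        (cokernel_desc_comp f g h hfg hgh) :=
      { τ₁ := Limits.cokernel.π f
        τ₂ := 𝟙 _
        τ₃ := 𝟙 _ }
    have : Epi φ.τ₁ := inferInstanceAs (Epi (Limits.cokernel.π f))
    have : IsIso φ.τ₂ := inferInstanceAs (IsIso (𝟙 _))
    have : Mono φ.τ₃ := inferInstanceAs (Mono (𝟙 _))
    exact (exact_iff_of_epi_of_isIso_of_mono φ).1 h2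

end CategoryTheory.ShortComplex

namespace groupCohomology

universe u
variable {k G : Type u} [CommRing k] [Group G]

lemma nonempty_equiv_ker_of_surjective {S : ShortComplex (Rep k G)} (hS : S.ShortExact) (n : ℕ)
    (h : Function.Surjective (map (MonoidHom.id G) S.f n).hom) :
    Nonempty (groupCohomology S.X₃ n ≃ₗ[k]
      LinearMap.ker (map (MonoidHom.id G) S.f (n + 1)).hom) := by
  have e2 := (mapShortComplex₂_exact hS n).moduleCat_range_eq_ker
  have e3 := (mapShortComplex₃_exact hS (rfl : n + 1 = n + 1)).moduleCat_range_eq_ker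
  have e1 := (mapShortComplex₁_exact hS (rfl : n + 1 = n + 1)).moduleCat_range_eq_ker
  change LinearMap.range (map (MonoidHom.id G) S.f n).hom =
    LinearMap.ker (map (MonoidHom.id G) S.g n).hom at e2
  change LinearMap.range (map (MonoidHom.id G) S.g n).hom =
    LinearMap.ker (δ hS n (n + 1) rfl).hom at e3
  change LinearMap.range (δ hS n (n + 1) rfl).hom =
    LinearMap.ker (map (MonoidHom.id G) S.f (n + 1)).hom at e1
  have hinj : Function.Injective (δ hS n (n + 1) rfl).hom := by
    rw [← LinearMap.ker_eq_bot, ← e3, LinearMap.range_eq_bot, ← LinearMap.ker_eq_top, ← e2]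
    exact LinearMap.range_eq_top.2 h
  exact ⟨LinearEquiv.ofInjective _ hinj ≪≫ₗ LinearEquiv.ofEq _ _ e1⟩

lemma nonempty_quotient_range_equiv_of_injective {S : ShortComplex (Rep k G)}
    (hS : S.ShortExact) (n : ℕ)
    (h : Function.Injective (map (MonoidHom.id G) S.g (n + 1)).hom) :
    Nonempty ((groupCohomology S.X₃ n ⧸ LinearMap.range (map (MonoidHom.id G) S.g n).hom) ≃ₗ[k]
      groupCohomology S.X₁ (n + 1)) := by
  have e2 := (mapShortComplex₂_exact hS (n + 1)).moduleCat_range_eq_ker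
  have e3 := (mapShortComplex₃_exact hS (rfl : n + 1 = n + 1)).moduleCat_range_eq_ker
  have e1 := (mapShortComplex₁_exact hS (rfl : n + 1 = n + 1)).moduleCat_range_eq_ker
  change LinearMap.range (map (MonoidHom.id G) S.f (n + 1)).hom =
    LinearMap.ker (map (MonoidHom.id G) S.g (n + 1)).hom at e2
  change LinearMap.range (map (MonoidHom.id G) S.g n).hom =
    LinearMap.ker (δ hS n (n + 1) rfl).hom at e3
  change LinearMap.range (δ hS n (n + 1) rfl).hom =
    LinearMap.ker (map (MonoidHom.id G) S.f (n + 1)).hom at e1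
  have hsurj : Function.Surjective (δ hS n (n + 1) rfl).hom := by
    rw [← LinearMap.range_eq_top, e1, LinearMap.ker_eq_top, ← LinearMap.range_eq_bot, e2]
    exact LinearMap.ker_eq_bot.2 h
  exact ⟨Submodule.quotEquivOfEq _ _ e3 ≪≫ₗ LinearMap.quotKerEquivOfSurjective _ hsurj⟩

section FourTerm

variable {A X Y B : Rep k G} {f : A ⟶ X} {g : X ⟶ Y} {h : Y ⟶ B}
  {hfg : f ≫ g = 0} {hgh : g ≫ h = 0} [Mono f] [Epi h]
  (h1 : (ShortComplex.mk f g hfg).Exact) (h2 : (ShortComplex.mk g h hgh).Exact)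

include h1 h2

lemma nonempty_quotient_range_equiv_ker (n : ℕ)
    (hf : Function.Surjective (map (MonoidHom.id G) f (n + 1)).hom)
    (hh : Function.Injective (map (MonoidHom.id G) h (n + 1)).hom) :
    Nonempty ((groupCohomology B n ⧸ LinearMap.range (map (MonoidHom.id G) h n).hom) ≃+
      LinearMap.ker (map (MonoidHom.id G) f (n + 2)).hom) := by
  obtain ⟨e⟩ := nonempty_quotient_range_equiv_of_injective
    (ShortComplex.shortExact_cokernel_desc f g h hfg hgh h1 h2) n hh
  obtain ⟨e'⟩ := nonempty_equiv_ker_of_surjective (ShortComplex.shortExact_cokernel f) (n + 1) hf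
  exact ⟨(e.trans e').toAddEquiv⟩

lemma injective_map_one (hf : Function.Surjective (map (MonoidHom.id G) f 0).hom)
    (hh : Function.Injective (map (MonoidHom.id G) h 0).hom) :
    Function.Injective (map (MonoidHom.id G) f 1).hom := by
  have hS := ShortComplex.shortExact_cokernel_desc f g h hfg hgh h1 h2
  obtain ⟨e⟩ := nonempty_equiv_ker_of_surjective (ShortComplex.shortExact_cokernel f) 0 hf
  have hmono := hS.mono_f
  have hinj := (ModuleCat.mono_iff_injective
    (map (MonoidHom.id G) (Limits.cokernel.desc f g hfg) 0)).1 (mono_map_0_of_mono _)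
  have hz : ∀ x, (map (MonoidHom.id G) h 0).hom
      ((map (MonoidHom.id G) (Limits.cokernel.desc f g hfg) 0).hom x) = 0 := fun x =>
    congr($((mapShortComplex₂ (ShortComplex.mk (Limits.cokernel.desc f g hfg) h
      (ShortComplex.cokernel_desc_comp f g h hfg hgh)) 0).zero).hom x)
  have : Subsingleton (groupCohomology (Limits.cokernel f) 0) :=
    subsingleton_of_forall_eq 0 fun x => hinj (hh (by
      rw [map_zero]
      exact (hz x).trans (map_zero _).symm))
  have := e.symm.toEquiv.subsingleton
  exact LinearMap.ker_eq_bot.1 (Submodule.eq_bot_of_subsingleton)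

end FourTerm
end groupCohomology

namespace ZMod

lemma exists_succ_sub_eq {M : Type*} [AddCommGroup M] {p : ℕ} [NeZero p] (ψ : ZMod p → M)
    (h : ∑ i, ψ i = 0) :
    ∃ φ : ZMod p → M, ∀ i, φ (i + 1) - φ i = ψ i := by
  refine ⟨fun i => ∑ j ∈ Finset.range i.val, ψ j, fun i => ?_⟩
  have hi := i.val_lt
  have key : ∑ j ∈ Finset.range (i.val + 1), ψ j = ∑ j ∈ Finset.range i.val, ψ j + ψ i := by
    rw [Finset.sum_range_succ, natCast_zmod_val]
  suffices ∑ j ∈ Finset.range (i + 1).val, ψ j = ∑ j ∈ Finset.range (i.val + 1), ψ j by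
    simp only [this, key, add_sub_cancel_left]
  have hv : (i + 1).val = (i.val + 1) % p := by
    rw [← val_natCast, Nat.cast_add, natCast_zmod_val, Nat.cast_one]
  rcases (Nat.succ_le_of_lt hi).lt_or_eq with h' | h'
  · rw [hv, Nat.mod_eq_of_lt h']
  · have hip : i.val + 1 = p := h'
    rw [hv, hip, Nat.mod_self, Finset.range_zero, Finset.sum_empty, ← h]
    refine (Finset.sum_bij (s := Finset.range p) (fun (j : ℕ) _ => (j : ZMod p))
      (fun _ _ => Finset.mem_univ _) ?_ ?_ (fun _ _ => rfl) : _ = ∑ i, ψ i).symm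
    · intro a ha b hb hab
      rw [Finset.mem_range] at ha hb
      simpa [val_natCast, Nat.mod_eq_of_lt ha, Nat.mod_eq_of_lt hb] using congrArg val hab
    · intro b _
      exact ⟨b.val, by simpa using b.val_lt, by simp⟩

lemma exists_two_mul_eq_one {p : ℕ} (hp : Odd p) : ∃ c : ZMod p, 2 * c = 1 := by
  obtain ⟨m, rfl⟩ := hp
  refine ⟨m + 1, ?_⟩
  have := natCast_self (2 * m + 1)
  push_cast at this
  linear_combination this

lemma exists_sub_eq {M : Type*} [AddCommGroup M] {p : ℕ} [NeZero p] (hp : Odd p) (ψ : ZMod p → M)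
    (h : ∑ i, ψ i = 0) :
    ∃ φ : ZMod p → M, ∀ i, φ (i + 1) - φ (i - 1) = ψ i := by
  obtain ⟨c, hc⟩ := exists_two_mul_eq_one hp
  let e : ZMod p ≃ ZMod p :=
    { toFun := fun i => 2 * i + 1
      invFun := fun i => (i - 1) * c
      left_inv := fun i => by linear_combination i * hc
      right_inv := fun i => by linear_combination (i - 1) * hc }
  obtain ⟨φ, hφ⟩ := exists_succ_sub_eq (ψ ∘ e) (by rw [← h]; exact e.sum_comp ψ)
  refine ⟨fun i => φ (i * c), fun i => ?_⟩
  have h1 := hφ ((i - 1) * c)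
  rw [Function.comp_apply, show e ((i - 1) * c) = i from e.right_inv i,
    show (i - 1) * c + 1 = (i + 1) * c by linear_combination -hc] at h1
  exact h1

lemma eq_of_forall_add_one_eq_sub_one {M : Type*} {p : ℕ} [NeZero p] (hp : Odd p) {φ : ZMod p → M}
    (h : ∀ i, φ (i + 1) = φ (i - 1)) (i : ZMod p) : φ i = φ 0 := by
  obtain ⟨c, hc⟩ := exists_two_mul_eq_one hp
  have key (m : ℕ) : φ (2 * m) = φ 0 := by
    induction m with
    | zero => simp
    | succ m ih =>
      rw [← ih, show (2 * ((m + 1 : ℕ) : ZMod p)) = (2 * m + 1) + 1 by push_cast; ring, h,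
        add_sub_cancel_right]
  have := key (i * c).val
  rwa [natCast_zmod_val, show 2 * (i * c) = i by linear_combination i * hc] at this

end ZMod

namespace DihedralGroup

variable {p : ℕ}

/-- The sign character, trivial on rotations and `-1` on reflections. -/
def sign (p : ℕ) : DihedralGroup p →* ℤˣ where
  toFun
    | r _ => 1
    | sr _ => -1
  map_one' := rfl
  map_mul' := by rintro (a | a) (b | b) <;> simp

@[simp] lemma sign_r (i : ZMod p) : sign p (r i) = 1 := rfl
@[simp] lemma sign_sr (i : ZMod p) : sign p (sr i) = -1 := rfl

lemma sign_mul_sign : sign p * sign p = 1 := by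
  ext (i | i) <;> simp

/-- The subgroup of order two generated by a reflection. -/
abbrev reflection (p : ℕ) : Subgroup (DihedralGroup p) := Subgroup.zpowers (sr 0)

lemma mem_reflection {g : DihedralGroup p} : g ∈ reflection p ↔ g = 1 ∨ g = sr 0 := by
  constructor
  · rintro ⟨n, rfl⟩
    have h2 : (sr 0 : DihedralGroup p) ^ (2 : ℤ) = 1 := by
      rw [zpow_two, sr_mul_self]
    rcases Int.even_or_odd' n with ⟨m, rfl | rfl⟩
    · simp [zpow_mul, h2]
    · simp [zpow_add, zpow_mul, h2]
  · rintro (rfl | rfl)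
    · exact one_mem _
    · exact Subgroup.mem_zpowers _

lemma card_reflection [Fintype (reflection p)] : Fintype.card (reflection p) = 2 := by
  rw [← Nat.card_eq_fintype_card, Nat.card_zpowers, orderOf_sr]

/-- The retraction of the dihedral group onto the subgroup generated by a reflection. -/
def retraction (p : ℕ) : DihedralGroup p →* reflection p where
  toFun
    | r _ => 1
    | sr _ => ⟨sr 0, Subgroup.mem_zpowers _⟩
  map_one' := rfl
  map_mul' := by rintro (a | a) (b | b) <;> ext <;> simp

lemma retraction_comp_subtype :
    (retraction p).comp (reflection p).subtype = MonoidHom.id _ := by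
  ext ⟨g, hg⟩
  rcases mem_reflection.1 hg with rfl | rfl <;> rfl

lemma map_r (hp : Odd p) (χ : DihedralGroup p →* ℤˣ) (i : ZMod p) : χ (r i) = 1 := by
  obtain ⟨c, hc⟩ := ZMod.exists_two_mul_eq_one hp
  have : r i = r (i * c) * r (i * c) := by
    rw [r_mul_r]
    congr 1
    linear_combination -i * hc
  rw [this, map_mul, Int.units_mul_self]

lemma map_sr (hp : Odd p) (χ : DihedralGroup p →* ℤˣ) (i : ZMod p) : χ (sr i) = χ (sr 0) := by
  have : (sr i : DihedralGroup p) = sr 0 * r i := by simp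
  rw [this, map_mul, map_r hp, mul_one]

lemma map_retraction (hp : Odd p) (χ : DihedralGroup p →* ℤˣ) (g : DihedralGroup p) :
    χ (retraction p g : DihedralGroup p) = χ g := by
  rcases g with i | i
  · rw [map_r hp]
    exact map_one χ
  · exact (map_sr hp χ i).symm

section Representation

variable {k : Type} [CommRing k]

variable (k) in
/-- The rank one representation attached to a character with values in `{1, -1}`. -/
noncomputable abbrev charRep (χ : DihedralGroup p →* ℤˣ) : Rep k (DihedralGroup p) :=
  Rep.of (X := k) (show Representation k (DihedralGroup p) k from
    { toFun := fun g => ((χ g : ℤ) : k) • LinearMap.id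
      map_one' := by ext; simp
      map_mul' := fun g h => by ext; simp [mul_comm] })

variable (k) in
/-- The representation of cochains of a regular polygon, coinduced from `charRep k χ`
restricted to the subgroup generated by a reflection. -/
noncomputable abbrev coindRep (χ : DihedralGroup p →* ℤˣ) : Rep k (DihedralGroup p) :=
  coind (reflection p).subtype (res (reflection p).subtype (charRep k χ))

lemma intCast_units_mul_self (u : ℤˣ) (x : k) : ((u : ℤ) : k) * (((u : ℤ) : k) * x) = x := by
  rw [← mul_assoc, ← Int.cast_mul, Int.units_coe_mul_self, Int.cast_one, one_mul]

lemma coindRep_sr {χ : DihedralGroup p →* ℤˣ} (F : coindRep k χ) (i : ZMod p) :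
    F.1 (sr i) = ((χ (sr 0) : ℤ) : k) * (F.1 (r i) : k) := by
  have := F.2 ⟨sr 0, Subgroup.mem_zpowers _⟩ (r i)
  simpa using this

lemma coindRep_ext {χ : DihedralGroup p →* ℤˣ} {F F' : coindRep k χ}
    (h : ∀ i, F.1 (r i) = F'.1 (r i)) : F = F' := by
  refine Subtype.ext (funext fun g => ?_)
  rcases g with i | i
  · exact h i
  · rw [coindRep_sr, coindRep_sr, h]

/-- The element of `coindRep k χ` with prescribed values on the rotations. -/
def coindRepMk (χ : DihedralGroup p →* ℤˣ) (φ : ZMod p → k) : coindRep k χ :=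
  ⟨fun | r i => φ i
       | sr i => ((χ (sr 0) : ℤ) : k) * φ i, by
    rintro ⟨g, hg⟩ (i | i) <;> rcases mem_reflection.1 hg with rfl | rfl
    · simp
    · simp
    · simp
    · simp [intCast_units_mul_self]⟩

/-- The coboundary map on cochains of a regular polygon. -/
noncomputable def coboundary (χ : DihedralGroup p →* ℤˣ) :
    coindRep k χ ⟶ coindRep k (χ * sign p) :=
  Rep.ofHom
    { toFun := fun F => ⟨fun g => (F.1 (r 1 * g) - F.1 (r (-1) * g) : k), by
        rintro ⟨g, hg⟩ (i | i) <;> rcases mem_reflection.1 hg with rfl | rfl <;>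
        simp [coindRep_sr, intCast_units_mul_self, ← sub_eq_add_neg, add_comm, mul_sub]⟩
      map_add' := fun F F' => by
        ext
        simp
        ring
      map_smul' := fun a F => by
        ext
        simp [mul_sub]
      isIntertwining' := fun g => by
        ext F h
        change F.1 (r 1 * h * g) - F.1 (r (-1) * h * g) =
          F.1 (r 1 * (h * g)) - F.1 (r (-1) * (h * g))
        rw [mul_assoc, mul_assoc] }

/-- Summation of the values of a cochain. -/
noncomputable def summation (hp : Odd p) [NeZero p] (χ : DihedralGroup p →* ℤˣ) :
    coindRep k χ ⟶ charRep k χ :=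
  Rep.ofHom
    { toFun := fun F => ∑ i, (F.1 (r i) : k)
      map_add' := fun F F' => by simp [Finset.sum_add_distrib]
      map_smul' := fun a F => by simp [Finset.mul_sum]
      isIntertwining' := fun g => by
        ext F
        change ∑ i, (F.1 (r i * g) : k) = ((χ g : ℤ) : k) * ∑ i, (F.1 (r i) : k)
        rcases g with j | j
        · simp only [map_r hp, Units.val_one, Int.cast_one, one_mul, r_mul_r]
          exact Equiv.sum_comp (Equiv.addRight j) fun i => (F.1 (r i) : k)
        · simp only [map_sr hp, r_mul_sr, coindRep_sr, ← Finset.mul_sum]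
          congr 1
          exact Equiv.sum_comp (Equiv.subLeft j) fun i => (F.1 (r i) : k) }

lemma coboundary_apply_r {χ : DihedralGroup p →* ℤˣ} (F : coindRep k χ) (i : ZMod p) :
    ((coboundary χ).hom F).1 (r i) = (F.1 (r (i + 1)) - F.1 (r (i - 1)) : k) := by
  change (F.1 (r 1 * r i) - F.1 (r (-1) * r i) : k) = _
  rw [r_mul_r, r_mul_r, add_comm 1, neg_add_eq_sub]

lemma summation_apply (hp : Odd p) [NeZero p] {χ : DihedralGroup p →* ℤˣ} (F : coindRep k χ) :
    (summation hp χ).hom F = ∑ i, (F.1 (r i) : k) := rfl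

lemma toCoind_apply_r (hp : Odd p) (χ : DihedralGroup p →* ℤˣ) (x : k) (i : ZMod p) :
    ((groupCohomology.toCoind (reflection p) (charRep k χ)).hom x).1 (r i) = x := by
  change ((χ (r i) : ℤ) : k) * x = x
  simp [map_r hp]

lemma toCoind_comp_coboundary (hp : Odd p) (χ : DihedralGroup p →* ℤˣ) :
    groupCohomology.toCoind (reflection p) (charRep k χ) ≫ coboundary (k := k) χ = 0 := by
  refine Rep.hom_ext (DFunLike.ext _ _ fun x => ?_)
  refine coindRep_ext fun i => ?_
  refine (coboundary_apply_r _ _).trans ?_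
  exact (congrArg₂ (fun a b : k => a - b) (toCoind_apply_r hp χ x _)
    (toCoind_apply_r hp χ x _)).trans (sub_self x)

lemma coboundary_comp_summation (hp : Odd p) [NeZero p] (χ : DihedralGroup p →* ℤˣ) :
    coboundary (k := k) χ ≫ summation hp (χ * sign p) = 0 := by
  refine Rep.hom_ext (DFunLike.ext _ _ fun F => ?_)
  refine (summation_apply hp _).trans ((Finset.sum_congr rfl fun i _ =>
    coboundary_apply_r F i).trans ?_)
  rw [Finset.sum_sub_distrib]
  exact sub_eq_zero.2 ((Equiv.sum_comp (Equiv.addRight 1) fun i => (F.1 (r i) : k)).trans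
    (Equiv.sum_comp (Equiv.subRight 1) fun i => (F.1 (r i) : k)).symm)

lemma toCoind_comp_summation (hp : Odd p) [NeZero p] (χ : DihedralGroup p →* ℤˣ) :
    groupCohomology.toCoind (reflection p) (charRep k χ) ≫ summation hp χ = (p : k) • 𝟙 _ := by
  refine Rep.hom_ext (DFunLike.ext _ _ fun x => ?_)
  refine (summation_apply hp _).trans ((Finset.sum_congr rfl fun i _ =>
    toCoind_apply_r hp χ x i).trans ?_)
  rw [Finset.sum_const, Finset.card_univ, ZMod.card, nsmul_eq_mul]
  rfl

lemma exact_toCoind_coboundary (hp : Odd p) [NeZero p] (χ : DihedralGroup p →* ℤˣ) :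
    (ShortComplex.mk (groupCohomology.toCoind (reflection p) (charRep k χ)) (coboundary χ)
      (toCoind_comp_coboundary hp χ)).Exact := by
  refine exact_of_ker_le_range _ _ _ fun F hF => ⟨F.1 (r 0), coindRep_ext fun i => ?_⟩
  rw [toCoind_apply_r hp]
  refine (ZMod.eq_of_forall_add_one_eq_sub_one hp (φ := fun i => (F.1 (r i) : k))
    (fun i => ?_) i).symm
  refine sub_eq_zero.1 ((coboundary_apply_r F i).symm.trans ?_)
  rw [hF]
  rfl

lemma exact_coboundary_summation (hp : Odd p) [NeZero p] (χ : DihedralGroup p →* ℤˣ) :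
    (ShortComplex.mk (coboundary (k := k) χ) (summation hp (χ * sign p))
      (coboundary_comp_summation hp χ)).Exact := by
  refine exact_of_ker_le_range _ _ _ fun F hF => ?_
  obtain ⟨φ, hφ⟩ := ZMod.exists_sub_eq hp (fun i => (F.1 (r i) : k))
    ((summation_apply hp F).symm.trans hF)
  exact ⟨coindRepMk χ φ, coindRep_ext fun i => (coboundary_apply_r _ i).trans (hφ i)⟩

lemma mono_toCoind (hp : Odd p) (χ : DihedralGroup p →* ℤˣ) :
    Mono (groupCohomology.toCoind (reflection p) (charRep k χ)) := by
  rw [Rep.mono_iff_injective]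
  intro x y hxy
  rw [← toCoind_apply_r hp χ x 0, ← toCoind_apply_r hp χ y 0]
  exact congr(($hxy).1 (r 0))

lemma epi_summation (hp : Odd p) [NeZero p] (χ : DihedralGroup p →* ℤˣ) :
    Epi (summation (k := k) hp χ) := by
  rw [Rep.epi_iff_surjective]
  intro x
  exact ⟨coindRepMk χ (Pi.single 0 x), (summation_apply hp _).trans
    (Fintype.sum_pi_single' 0 x)⟩

end Representation

section Cohomology

variable (χ : DihedralGroup p →* ℤˣ)

/-- The map induced on cohomology by the unit of the restriction-coinduction adjunction. -/
noncomputable abbrev restriction (n : ℕ) :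
    groupCohomology (charRep ℤ χ) n →ₗ[ℤ] groupCohomology (coindRep ℤ χ) n :=
  (groupCohomology.map (MonoidHom.id _)
    (groupCohomology.toCoind (reflection p) (charRep ℤ χ)) n).hom

/-- The map induced on cohomology by summation. -/
noncomputable abbrev transfer (hp : Odd p) [NeZero p] (n : ℕ) :
    groupCohomology (coindRep ℤ χ) n →ₗ[ℤ] groupCohomology (charRep ℤ χ) n :=
  (groupCohomology.map (MonoidHom.id _) (summation hp χ) n).hom

instance : CommGroup (reflection p) where
  mul_comm := by
    rintro ⟨_, m, rfl⟩ ⟨_, n, rfl⟩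
    exact Subtype.ext (zpow_mul_comm _ m n)

lemma mem_zpowers_generator (x : reflection p) :
    x ∈ Subgroup.zpowers (⟨sr 0, Subgroup.mem_zpowers _⟩ : reflection p) := by
  obtain ⟨_, n, rfl⟩ := x
  exact ⟨n, Subtype.ext rfl⟩

lemma restriction_surjective (hp : Odd p) [NeZero p] (n : ℕ) :
    Function.Surjective (restriction χ n) := by
  have := Fintype.ofFinite (reflection p)
  have : IsNoetherian ℤ (res (reflection p).subtype (charRep ℤ χ)).V :=
    inferInstanceAs (IsNoetherian ℤ ℤ)
  have := FiniteCyclicGroup.isNoetherian_groupCohomology (C := reflection p)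
    (res (reflection p).subtype (charRep ℤ χ)) _ mem_zpowers_generator n
  refine groupCohomology.map_toCoind_surjective _ _ (retraction p) retraction_comp_subtype
    (fun g => ?_) n
  refine LinearMap.ext fun x => ?_
  change ((χ (retraction p g) : ℤ) : ℤ) * (x : ℤ) = ((χ g : ℤ) : ℤ) * (x : ℤ)
  rw [map_retraction hp]

lemma two_nsmul_groupCohomology_coindRep [NeZero p] {n : ℕ} (hn : n ≠ 0)
    (x : groupCohomology (coindRep ℤ χ) n) : 2 • x = 0 := by
  have := Fintype.ofFinite (reflection p)
  let e := (groupCohomology.coindIso (res (reflection p).subtype (charRep ℤ χ)) n).toLinearEquiv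
  have h := FiniteCyclicGroup.card_nsmul_eq_zero (C := reflection p)
    (res (reflection p).subtype (charRep ℤ χ)) _ mem_zpowers_generator n hn (e x)
  rw [card_reflection] at h
  exact e.injective (by rw [map_nsmul, map_zero, h])

lemma transfer_restriction (hp : Odd p) [NeZero p] (n : ℕ) (x : groupCohomology (charRep ℤ χ) n) :
    transfer χ hp n (restriction χ n x) = p • x := by
  rw [← groupCohomology.map_natCast_smul_id_apply, ← toCoind_comp_summation hp,
    groupCohomology.map_id_comp]
  rfl

lemma restriction_transfer (hp : Odd p) [NeZero p] {n : ℕ} (hn : n ≠ 0)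
    (x : groupCohomology (coindRep ℤ χ) n) : restriction χ n (transfer χ hp n x) = x := by
  obtain ⟨y, rfl⟩ := restriction_surjective χ hp n x
  rw [transfer_restriction, map_nsmul]
  obtain ⟨m, hm⟩ := id hp
  have (q : ℕ) (hq : q = 2 * m + 1) : q • restriction χ n y = restriction χ n y := by
    rw [hq, add_nsmul, mul_nsmul, two_nsmul_groupCohomology_coindRep χ hn, nsmul_zero, zero_add,
      one_nsmul]
  exact this p hm

lemma transfer_injective_of_ne_zero (hp : Odd p) [NeZero p] {n : ℕ} (hn : n ≠ 0) :
    Function.Injective (transfer χ hp n) :=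
  Function.LeftInverse.injective (restriction_transfer χ hp hn)

/-- Cohomology in degree zero consists of the invariants. -/
noncomputable def zeroEquiv :
    groupCohomology (charRep ℤ χ) 0 ≃ₗ[ℤ] (charRep ℤ χ).ρ.invariants :=
  (groupCohomology.H0Iso (charRep ℤ χ)).toLinearEquiv

lemma transfer_injective (hp : Odd p) [NeZero p] (n : ℕ) :
    Function.Injective (transfer χ hp n) := by
  rcases eq_or_ne n 0 with rfl | hn
  · rw [← LinearMap.ker_eq_bot]
    refine LinearMap.ker_eq_bot'.2 fun x hx => ?_
    obtain ⟨y, rfl⟩ := restriction_surjective χ hp 0 x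
    rw [transfer_restriction] at hx
    have h : p • (zeroEquiv χ y).1 = (0 : ℤ) := by
      have := congrArg (fun z => ((zeroEquiv χ z).1 : ℤ)) hx
      simpa using this
    have : y = 0 := (zeroEquiv χ).injective (Subtype.ext (by
      simpa [NeZero.ne p] using h))
    rw [this, map_zero]
  · exact transfer_injective_of_ne_zero χ hp hn

lemma range_transfer_zero (hp : Odd p) [NeZero p] (x : groupCohomology (charRep ℤ χ) 0) :
    x ∈ LinearMap.range (transfer χ hp 0) ↔ ∃ y, p • y = x := by
  constructor
  · rintro ⟨y, rfl⟩
    obtain ⟨z, rfl⟩ := restriction_surjective χ hp 0 y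
    exact ⟨z, (transfer_restriction χ hp 0 z).symm⟩
  · rintro ⟨y, rfl⟩
    exact ⟨_, transfer_restriction χ hp 0 y⟩

lemma ker_restriction_one (hp : Odd p) [NeZero p] : LinearMap.ker (restriction χ 1) = ⊥ := by
  have := mono_toCoind (k := ℤ) hp χ
  have := epi_summation (k := ℤ) hp (χ * sign p)
  exact LinearMap.ker_eq_bot.2 (groupCohomology.injective_map_one
    (exact_toCoind_coboundary hp χ) (exact_coboundary_summation hp χ)
    (restriction_surjective χ hp 0) (transfer_injective _ hp 0))

lemma nonempty_quotient_range_transfer_equiv (hp : Odd p) [NeZero p] (n : ℕ) :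
    Nonempty ((groupCohomology (charRep ℤ (χ * sign p)) n ⧸
      LinearMap.range (transfer (χ * sign p) hp n)) ≃+
      LinearMap.ker (restriction χ (n + 2))) := by
  have := mono_toCoind (k := ℤ) hp χ
  have := epi_summation (k := ℤ) hp (χ * sign p)
  obtain ⟨e⟩ := groupCohomology.nonempty_quotient_range_equiv_ker
    (exact_toCoind_coboundary hp χ) (exact_coboundary_summation hp χ) n
    (restriction_surjective χ hp _) (transfer_injective _ hp _)
  exact ⟨e⟩

lemma nonempty_ker_restriction_equiv (hp : Odd p) [NeZero p] {n : ℕ} (hn : n ≠ 0) :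
    Nonempty (LinearMap.ker (restriction χ (n + 2)) ≃+
      LinearMap.ker (restriction (χ * sign p) n)) := by
  obtain ⟨e⟩ := nonempty_quotient_range_transfer_equiv χ hp n
  obtain ⟨e'⟩ := nonempty_quotient_range_equiv_ker_of_rightInverse _ _
    (restriction_transfer (χ * sign p) hp hn)
  exact ⟨e.symm.trans e'⟩

lemma nonempty_ker_restriction_add_four_equiv (hp : Odd p) [NeZero p] {n : ℕ} (hn : n ≠ 0) :
    Nonempty (LinearMap.ker (restriction χ (n + 4)) ≃+ LinearMap.ker (restriction χ n)) := by
  obtain ⟨e⟩ := nonempty_ker_restriction_equiv χ hp (n := n + 2) (by simp)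
  obtain ⟨e'⟩ := nonempty_ker_restriction_equiv (χ * sign p) hp hn
  rw [mul_assoc, sign_mul_sign, mul_one] at e'
  exact ⟨e.trans e'⟩

lemma subsingleton_groupCohomology_sign_zero :
    Subsingleton (groupCohomology (charRep ℤ (sign p)) 0) := by
  refine (zeroEquiv (sign p)).toEquiv.subsingleton_congr.2 (subsingleton_of_forall_eq 0 ?_)
  rintro ⟨x, hx⟩
  have : ((sign p (sr 0) : ℤ) : ℤ) * (x : ℤ) = x := hx (sr 0)
  simp only [sign_sr, Units.val_neg, Units.val_one, neg_mul,
    one_mul] at this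
  exact Subtype.ext (show (x : ℤ) = 0 by lia)

lemma nonempty_quotient_range_transfer_zero_equiv (hp : Odd p) [NeZero p] :
    Nonempty ((groupCohomology (charRep ℤ (1 : DihedralGroup p →* ℤˣ)) 0 ⧸
      LinearMap.range (transfer 1 hp 0)) ≃+ ZMod p) := by
  have h1 : ∀ z : ℤ, z ∈ (charRep ℤ (1 : DihedralGroup p →* ℤˣ)).ρ.invariants := fun z g =>
    one_mul z
  let f := (LinearMap.id (R := ℤ) (M := ℤ)).codRestrict
    (charRep ℤ (1 : DihedralGroup p →* ℤˣ)).ρ.invariants h1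
  refine nonempty_addEquiv_zmod p
    ((Submodule.mkQ _).toAddMonoidHom.comp ((zeroEquiv 1).symm.toLinearMap ∘ₗ f).toAddMonoidHom)
    ?_ fun z => ?_
  · intro x
    obtain ⟨y, rfl⟩ := Submodule.mkQ_surjective _ x
    refine ⟨((zeroEquiv 1 y).1 : ℤ), congrArg (Submodule.mkQ _) ?_⟩
    exact (zeroEquiv 1).symm_apply_apply y
  · refine (Submodule.Quotient.mk_eq_zero _).trans ((range_transfer_zero _ hp _).trans ?_)
    constructor
    · rintro ⟨y, hy⟩
      refine ⟨((zeroEquiv 1 y).1 : ℤ), ?_⟩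
      have := congrArg (fun w => ((zeroEquiv 1 w).1 : ℤ)) hy
      simpa [f] using this.symm
    · rintro ⟨w, rfl⟩
      refine ⟨(zeroEquiv 1).symm (f w), ?_⟩
      rw [← map_nsmul]
      refine congrArg (zeroEquiv 1).symm (Subtype.ext ?_)
      simp [f]

lemma nonempty_ker_restriction_add_four_mul_equiv (hp : Odd p) [NeZero p] {n : ℕ} (hn : n ≠ 0)
    (m : ℕ) :
    Nonempty (LinearMap.ker (restriction χ (n + 4 * m)) ≃+ LinearMap.ker (restriction χ n)) := by
  induction m with
  | zero => exact ⟨AddEquiv.refl _⟩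
  | succ m ih =>
    obtain ⟨e⟩ := ih
    obtain ⟨e'⟩ := nonempty_ker_restriction_add_four_equiv χ hp (n := n + 4 * m) (by simp [hn])
    exact ⟨e'.trans e⟩

lemma subsingleton_ker_restriction_one_two (hp : Odd p) [NeZero p] :
    Subsingleton (LinearMap.ker (restriction (1 : DihedralGroup p →* ℤˣ) 2)) := by
  obtain ⟨e⟩ := nonempty_quotient_range_transfer_equiv (1 : DihedralGroup p →* ℤˣ) hp 0
  rw [one_mul] at e
  have := subsingleton_groupCohomology_sign_zero (p := p)
  exact e.symm.toEquiv.subsingleton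

lemma nonempty_ker_restriction_one_four_equiv (hp : Odd p) [NeZero p] :
    Nonempty (LinearMap.ker (restriction (1 : DihedralGroup p →* ℤˣ) 4) ≃+ ZMod p) := by
  obtain ⟨e⟩ := nonempty_quotient_range_transfer_equiv (sign p) hp 0
  rw [sign_mul_sign] at e
  obtain ⟨e'⟩ := nonempty_ker_restriction_equiv (1 : DihedralGroup p →* ℤˣ) hp two_ne_zero
  rw [one_mul] at e'
  obtain ⟨e₂⟩ := nonempty_quotient_range_transfer_zero_equiv hp
  exact ⟨e'.trans (e.symm.trans e₂)⟩

lemma subsingleton_ker_restriction_one (hp : Odd p) [NeZero p] {n : ℕ} (hn : n % 4 ≠ 0) :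
    Subsingleton (LinearMap.ker (restriction (1 : DihedralGroup p →* ℤˣ) n)) := by
  have h0 : n % 4 < 4 := Nat.mod_lt _ (by norm_num)
  obtain ⟨e⟩ := nonempty_ker_restriction_add_four_mul_equiv (1 : DihedralGroup p →* ℤˣ) hp hn
    (n / 4)
  rw [Nat.mod_add_div] at e
  have h1 (χ : DihedralGroup p →* ℤˣ) : Subsingleton (LinearMap.ker (restriction χ 1)) := by
    rw [ker_restriction_one χ hp]
    infer_instance
  suffices Subsingleton (LinearMap.ker (restriction (1 : DihedralGroup p →* ℤˣ) (n % 4))) from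
    e.toEquiv.subsingleton
  interval_cases n % 4
  · exact absurd rfl hn
  · exact h1 1
  · exact subsingleton_ker_restriction_one_two hp
  · obtain ⟨e'⟩ := nonempty_ker_restriction_equiv (1 : DihedralGroup p →* ℤˣ) hp one_ne_zero
    have := h1 (1 * sign p)
    exact e'.toEquiv.subsingleton

lemma nonempty_ker_restriction_one_equiv (hp : Odd p) [NeZero p] {n : ℕ} (h0 : n ≠ 0)
    (hn : n % 4 = 0) :
    Nonempty (LinearMap.ker (restriction (1 : DihedralGroup p →* ℤˣ) n) ≃+ ZMod p) := by
  obtain ⟨m, rfl⟩ : ∃ m, n = 4 + 4 * m := ⟨n / 4 - 1, by lia⟩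
  obtain ⟨e⟩ := nonempty_ker_restriction_add_four_mul_equiv (1 : DihedralGroup p →* ℤˣ) hp
    four_ne_zero m
  obtain ⟨e'⟩ := nonempty_ker_restriction_one_four_equiv hp
  exact ⟨e.trans e'⟩

lemma charRep_one : charRep ℤ (1 : DihedralGroup p →* ℤˣ) = trivial ℤ (DihedralGroup p) ℤ := by
  refine congrArg (Rep.of (X := ℤ)) (MonoidHom.ext fun g => LinearMap.ext fun x => ?_)
  exact one_mul x

lemma nonempty_groupCohomology_coindRep_one_equiv (n : ℕ) :
    Nonempty (groupCohomology (coindRep ℤ (1 : DihedralGroup p →* ℤˣ)) n ≃+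
      groupCohomology (trivial ℤ (reflection p) ℤ) n) := by
  have h : res (reflection p).subtype (charRep ℤ (1 : DihedralGroup p →* ℤˣ)) =
      trivial ℤ (reflection p) ℤ := by
    rw [charRep_one]
    rfl
  rw [← h]
  exact ⟨(groupCohomology.coindIso _ n).toLinearEquiv.toAddEquiv⟩

lemma nonempty_groupCohomology_trivial_equiv_prod (hp : Odd p) [NeZero p] {n : ℕ} (hn : n ≠ 0) :
    Nonempty (groupCohomology (trivial ℤ (DihedralGroup p) ℤ) n ≃+
      groupCohomology (trivial ℤ (reflection p) ℤ) n ×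
        LinearMap.ker (restriction (1 : DihedralGroup p →* ℤˣ) n)) := by
  obtain ⟨e⟩ := nonempty_equiv_prod_of_rightInverse _ _
    (restriction_transfer (1 : DihedralGroup p →* ℤˣ) hp hn)
  obtain ⟨e'⟩ := nonempty_groupCohomology_coindRep_one_equiv (p := p) n
  rw [← charRep_one]
  exact ⟨e.trans (e'.prodCongr (AddEquiv.refl _))⟩

lemma nonempty_groupCohomology_trivial_reflection_equiv {n : ℕ} [NeZero p] (h0 : n ≠ 0)
    (hn : Even n) : Nonempty (groupCohomology (trivial ℤ (reflection p) ℤ) n ≃+ ZMod 2) := by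
  have := Fintype.ofFinite (reflection p)
  have h := FiniteCyclicGroup.groupCohomology_trivial_int_of_even (reflection p) _
    mem_zpowers_generator n h0 hn
  rw [card_reflection] at h
  exact h

lemma subsingleton_groupCohomology_trivial_reflection {n : ℕ} [NeZero p] (hn : Odd n) :
    Subsingleton (groupCohomology (trivial ℤ (reflection p) ℤ) n) := by
  have := Fintype.ofFinite (reflection p)
  exact FiniteCyclicGroup.subsingleton_groupCohomology_trivial_int_of_odd (reflection p) _
    mem_zpowers_generator n hn

end Cohomology

end DihedralGroup

end

/-- The integral group cohomology of the dihedral group `D_{2p}` (`p` an odd prime)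
in positive degrees is 4-periodic with pattern `ℤ/2p, 0, ℤ/2, 0`. -/
theorem groupCohomology_dihedral_trivial_int (p : ℕ) (hp : p.Prime) (hodd : Odd p)
    (n : ℕ) (hn : 1 ≤ n) :
    (n % 4 = 0 →
      Nonempty ((groupCohomology (Rep.trivial ℤ (DihedralGroup p) ℤ) n) ≃ₗ[ℤ]
        ZMod (2 * p))) ∧
    (n % 2 = 1 →
      Subsingleton (groupCohomology (Rep.trivial ℤ (DihedralGroup p) ℤ) n)) ∧
    (n % 4 = 2 →
      Nonempty ((groupCohomology (Rep.trivial ℤ (DihedralGroup p) ℤ) n) ≃ₗ[ℤ]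
        ZMod 2)) := by
  have : NeZero p := ⟨hp.ne_zero⟩
  have h0 : n ≠ 0 := Nat.one_le_iff_ne_zero.1 hn
  obtain ⟨e⟩ := DihedralGroup.nonempty_groupCohomology_trivial_equiv_prod hodd h0
  refine ⟨fun h => ?_, fun h => ?_, fun h => ?_⟩
  · obtain ⟨e1⟩ := DihedralGroup.nonempty_groupCohomology_trivial_reflection_equiv (p := p) h0
      (Nat.even_iff.2 (by lia))
    obtain ⟨e2⟩ := DihedralGroup.nonempty_ker_restriction_one_equiv hodd h0 h
    exact ⟨(e.trans ((e1.prodCongr e2).trans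
      (ZMod.chineseRemainder hodd.coprime_two_left).symm.toAddEquiv)).toLinearEquivInt⟩
  · have := DihedralGroup.subsingleton_groupCohomology_trivial_reflection (p := p)
      (Nat.odd_iff.2 h)
    have := DihedralGroup.subsingleton_ker_restriction_one (p := p) (n := n) hodd (by lia)
    exact e.toEquiv.subsingleton
  · obtain ⟨e1⟩ := DihedralGroup.nonempty_groupCohomology_trivial_reflection_equiv (p := p) h0
      (Nat.even_iff.2 (by lia))
    have := DihedralGroup.subsingleton_ker_restriction_one (p := p) (n := n) hodd (by lia)
    have := uniqueOfSubsingleton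
      (0 : LinearMap.ker (DihedralGroup.restriction (1 : DihedralGroup p →* ℤˣ) n))
    exact ⟨(e.trans (AddEquiv.prodUnique.trans e1)).toLinearEquivInt⟩
end

section
/- Let p be a prime and let G = (ZMod p) × (ZMod p). For every positive integer d, it is NOT the case that for every n ≥ 1 the group cohomology H^n(G; ℤ) (with trivial ℤ coefficients) is isomorphic to H^{n+d}(G; ℤ). In other words, the integral group cohomology of C_p × C_p in positive degrees is not periodic of any period d ≥ 1. -/
section BarComplex

variable {G : Type*}

/-- Contraction of cochains with a group element `g`: the alternating sum of the insertions of `g`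
in all positions. -/
def slant (g : G) : (List G → ℤ) → List G → ℤ
  | F, [] => F [g]
  | F, a :: r => F (g :: a :: r) - slant g (fun l => F (a :: l)) r

/-- The cup product of a 2-cochain with a family of cochains. -/
def cupTwo (y : G → G → ℤ) (F : List G → ℤ) : List G → ℤ
  | a :: b :: r => y a b * F r
  | _ => 0

/-- The integral Bockstein of the cup product of two classes of degree one. -/
def bocksteinCochain (x₁ x₂ : G → ℤ) (y₁ y₂ : G → G → ℤ) : List G → ℤ
  | [a, b, c] => y₁ a b * x₂ c - x₁ a * y₂ b c
  | _ => 0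

/-- Evaluation of a cochain of degree `2 * k` on the chain `∑ [t | s i₁ | t | s i₂ | ⋯ ]`. -/
def periodicSum {ι : Type*} [Fintype ι] (t : G) (s : ι → G) : ℕ → (List G → ℤ) → ℤ
  | 0, F => F []
  | k + 1, F => periodicSum t s k (fun l => ∑ i, F (t :: s i :: l))

lemma slant_congr (g : G) {n : ℕ} {F F' : List G → ℤ}
    (h : ∀ l : List G, l.length = n + 1 → F l = F' l) (l : List G) (hl : l.length = n) :
    slant g F l = slant g F' l := by
  induction l generalizing n F F' with
  | nil => exact h _ (by simpa using hl.symm)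
  | cons a r ih =>
    obtain ⟨m, rfl⟩ : ∃ m, n = m + 1 := ⟨r.length, by simp [← hl]⟩
    simp only [slant]
    rw [h _ (by simpa using hl),
      ih (n := m) (fun l hl' => h (a :: l) (by simpa using hl')) (by simpa using hl)]

lemma slant_add (g : G) (F F' : List G → ℤ) (l : List G) :
    slant g (fun l => F l + F' l) l = slant g F l + slant g F' l := by
  induction l generalizing F F' with
  | nil => simp [slant]
  | cons a r ih =>
    simp only [slant]
    rw [ih (fun l => F (a :: l)) (fun l => F' (a :: l))]
    ring

lemma slant_const_mul (g : G) (c : ℤ) (F : List G → ℤ) (l : List G) :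
    slant g (fun l => c * F l) l = c * slant g F l := by
  induction l generalizing F with
  | nil => simp [slant]
  | cons a r ih =>
    simp only [slant]
    rw [ih (fun l => F (a :: l))]
    ring

lemma slant_sub (g : G) (F F' : List G → ℤ) (l : List G) :
    slant g (fun l => F l - F' l) l = slant g F l - slant g F' l := by
  have h := slant_add g F (fun l => (-1) * F' l) l
  rw [slant_const_mul] at h
  simpa [sub_eq_add_neg] using h

lemma periodicSum_congr {ι : Type*} [Fintype ι] (t : G) (s : ι → G) {m : ℤ} (k : ℕ)
    {F F' : List G → ℤ}
    (h : ∀ l : List G, l.length = 2 * k → (∀ a ∈ l.head?, a = t) → F l ≡ F' l [ZMOD m]) :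
    periodicSum t s k F ≡ periodicSum t s k F' [ZMOD m] := by
  induction k generalizing F F' with
  | zero => exact h [] rfl (by simp)
  | succ k ih =>
    refine ih fun l hl _ => ?_
    exact Int.ModEq.sum fun i _ => h _ (by simp [hl]; ring) (by simp)

/-- The cocycle `y₂ᵏ ∪ β(x₁ ∪ x₂)` of degree `2 * k + 3`. -/
def oddCochain (x₁ x₂ : G → ℤ) (y₁ y₂ : G → G → ℤ) (k : ℕ) : List G → ℤ :=
  (cupTwo y₂)^[k] (bocksteinCochain x₁ x₂ y₁ y₂)

lemma periodicSum_slant_oddCochain {ι : Type*} [Fintype ι] (g t : G) (s : ι → G)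
    {x₁ x₂ : G → ℤ} {y₁ y₂ : G → G → ℤ} (hxg : x₁ g = 1) (hxt : x₁ t = 0)
    (hy₁ : ∀ i, y₁ t (s i) = 0) (hgt : y₁ g t = 0) (htg : y₁ t g = 0)
    (hg : ∀ a, y₂ g a = 0) (hg' : y₂ t g = 0)
    (hy₂ : ∑ i, y₂ t (s i) = 1) (k : ℕ) :
    periodicSum t s (k + 1) (slant g (oddCochain x₁ x₂ y₁ y₂ k)) = -1 := by
  induction k with
  | zero => simp [periodicSum, slant, oddCochain, bocksteinCochain, hxg, hxt, hy₁, hgt, htg, hy₂]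
  | succ k ih =>
    rw [← ih, periodicSum]
    congr 1
    ext l
    have h (i : ι) : slant g (oddCochain x₁ x₂ y₁ y₂ (k + 1)) (t :: s i :: l) =
        y₂ t (s i) * slant g (oddCochain x₁ x₂ y₁ y₂ k) l := by
      rw [← slant_const_mul]
      simp [oddCochain, slant, Function.iterate_succ_apply', cupTwo, hg, hg']
    simp only [h, ← Finset.sum_mul, hy₂, one_mul]

variable [CommGroup G]

/-- The inhomogeneous bar differential with trivial integral coefficients, where a family of
cochains of all degrees is encoded as a function on lists. -/
def barD : (List G → ℤ) → List G → ℤ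
  | _, [] => 0
  | _, [_] => 0
  | F, a :: b :: r =>
      F (b :: r) - F (a * b :: r) + F (a :: r) - barD (fun l => F (a :: l)) (b :: r)

lemma barD_const_mul (c : ℤ) (F : List G → ℤ) (l : List G) :
    barD (fun l => c * F l) l = c * barD F l := by
  induction l generalizing F with
  | nil => simp [barD]
  | cons a r ih =>
    cases r with
    | nil => simp [barD]
    | cons b r =>
      simp only [barD]
      rw [ih (fun l => F (a :: l))]
      ring

lemma barD_sum {ι : Type*} (S : Finset ι) (F : ι → List G → ℤ) (l : List G) :
    barD (fun l => ∑ i ∈ S, F i l) l = ∑ i ∈ S, barD (F i) l := by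
  induction l generalizing F with
  | nil => simp [barD]
  | cons a r ih =>
    cases r with
    | nil => simp [barD]
    | cons b r =>
      simp only [barD]
      rw [ih (fun i l => F i (a :: l))]
      simp only [Finset.sum_sub_distrib, Finset.sum_add_distrib]

lemma barD_sub (F F' : List G → ℤ) (l : List G) :
    barD (fun l => F l - F' l) l = barD F l - barD F' l := by
  induction l generalizing F F' with
  | nil => simp [barD]
  | cons a r ih =>
    cases r with
    | nil => simp [barD]
    | cons b r =>
      simp only [barD]
      rw [ih (fun l => F (a :: l)) (fun l => F' (a :: l))]
      ring

lemma slant_barD (g : G) (F : List G → ℤ) (l : List G) :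
    slant g (barD F) l = -barD (slant g F) l := by
  induction l generalizing F with
  | nil => simp [slant, barD]
  | cons a r ih =>
    cases r with
    | nil =>
      simp [slant, barD, mul_comm g a]
      ring
    | cons b r =>
      have key : slant g (fun l => barD F (a :: l)) (b :: r) =
          slant g F (b :: r) - slant g (fun l => F (l.modifyHead (a * ·))) (b :: r)
            + slant g (fun l => F (a :: l.tail)) (b :: r)
            - slant g (barD fun l => F (a :: l)) (b :: r) := by
        rw [← slant_sub, ← slant_add, ← slant_sub]
        refine slant_congr g (n := r.length + 1) (fun l hl => ?_) _ (by simp)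
        obtain ⟨c, l, rfl⟩ := List.exists_cons_of_length_eq_add_one hl
        simp [barD]
      rw [slant, key, ih]
      have e : (fun l => slant g F (a :: l)) =
          fun l => F (g :: a :: l) - slant g (fun l => F (a :: l)) l := rfl
      simp only [barD, e]
      rw [barD_sub (fun l => F (g :: a :: l)) (slant g fun l => F (a :: l))]
      simp [slant, mul_comm g a]
      ring

lemma barD_cupTwo {y : G → G → ℤ}
    (hy : ∀ a b c, y b c - y (a * b) c + y a (b * c) - y a b = 0)
    {F : List G → ℤ} (hF : ∀ l, barD F l = 0) (l : List G) : barD (cupTwo y F) l = 0 := by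
  match l with
  | [] => rfl
  | [_] => rfl
  | [_, _] => simp [barD, cupTwo]
  | a :: b :: c :: r =>
    have h := barD_const_mul (y a b) F (c :: r)
    rw [hF] at h
    simp only [barD, cupTwo, h]
    linear_combination F r * hy a b c

lemma cocycle_of_coboundary_multiple {p : ℤ} (hp : p ≠ 0) {x : G → ℤ} {y : G → G → ℤ}
    (h : ∀ a b, x b - x (a * b) + x a = p * y a b) (a b c : G) :
    y b c - y (a * b) c + y a (b * c) - y a b = 0 := by
  apply mul_left_cancel₀ hp
  have h₁ := h (a * b) c
  rw [mul_assoc] at h₁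
  linear_combination h₁ + h a b - h b c - h a (b * c)

lemma barD_bocksteinCochain {p : ℤ} (hp : p ≠ 0) {x₁ x₂ : G → ℤ} {y₁ y₂ : G → G → ℤ}
    (h₁ : ∀ a b, x₁ b - x₁ (a * b) + x₁ a = p * y₁ a b)
    (h₂ : ∀ a b, x₂ b - x₂ (a * b) + x₂ a = p * y₂ a b) (l : List G) :
    barD (bocksteinCochain x₁ x₂ y₁ y₂) l = 0 := by
  match l with
  | [] => rfl
  | [_] => rfl
  | [_, _] => simp [barD, bocksteinCochain]
  | [_, _, _] => simp [barD, bocksteinCochain]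
  | [a, b, c, d] =>
    simp only [barD, bocksteinCochain]
    linear_combination x₂ d * cocycle_of_coboundary_multiple hp h₁ a b c
      - y₂ c d * h₁ a b + y₁ a b * h₂ c d + x₁ a * cocycle_of_coboundary_multiple hp h₂ b c d
  | a :: b :: c :: d :: e :: r =>
    have h : ∀ l : List G, barD (fun _ => (0 : ℤ)) l = 0 := fun l => by
      simpa using barD_const_mul 0 (fun _ : List G => (0 : ℤ)) l
    simp [barD, bocksteinCochain, h]

lemma periodicSum_barD {ι : Type*} [Fintype ι] (t : G) (s : ι → G) (σ : Equiv.Perm ι)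
    (hs : ∀ i, t * s i = s (σ i)) (k : ℕ)
    (F : List G → ℤ) : periodicSum t s k (barD F) ≡ 0 [ZMOD Fintype.card ι] := by
  induction k generalizing F with
  | zero => rfl
  | succ k ih =>
    refine (periodicSum_congr t s k fun l _ hl => ?_).trans (ih fun l => ∑ i, F (t :: s i :: l))
    have hσ : ∀ f : G → ℤ, ∑ i, f (t * s i) = ∑ i, f (s i) := fun f => by
      simp only [hs]
      exact Equiv.sum_comp σ (fun i => f (s i))
    rw [barD_sum Finset.univ (fun i l => F (t :: s i :: l))]
    cases l with
    | nil =>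
      simp [barD, Finset.sum_add_distrib, Finset.sum_sub_distrib, hσ fun a => F [a],
        Int.modEq_zero_iff_dvd]
    | cons b r =>
      obtain rfl : b = t := hl b rfl
      simp only [barD, Finset.sum_add_distrib, Finset.sum_sub_distrib,
        hσ fun a => F (a :: b :: r), mul_comm (s _) b, hσ fun a => F (b :: a :: r)]
      ring_nf
      rfl


lemma barD_oddCochain {p : ℤ} (hp : p ≠ 0) {x₁ x₂ : G → ℤ} {y₁ y₂ : G → G → ℤ}
    (h₁ : ∀ a b, x₁ b - x₁ (a * b) + x₁ a = p * y₁ a b)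
    (h₂ : ∀ a b, x₂ b - x₂ (a * b) + x₂ a = p * y₂ a b) (k : ℕ) (l : List G) :
    barD (oddCochain x₁ x₂ y₁ y₂ k) l = 0 := by
  induction k generalizing l with
  | zero => exact barD_bocksteinCochain hp h₁ h₂ l
  | succ k ih =>
    rw [oddCochain, Function.iterate_succ_apply']
    exact barD_cupTwo (cocycle_of_coboundary_multiple hp h₂) ih l

lemma contractNth_zero_mul {n : ℕ} (g : Fin (n + 2) → G) :
    Fin.contractNth 0 (· * ·) g =
      Fin.cons (g 0 * g 1) (fun i : Fin n => g i.succ.succ) := by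
  ext i
  refine Fin.cases ?_ (fun i => ?_) i <;> simp [Fin.contractNth]

lemma contractNth_succ_mul {n : ℕ} (j : Fin (n + 1)) (g : Fin (n + 2) → G) :
    Fin.contractNth j.succ (· * ·) g =
      Fin.cons (g 0) (Fin.contractNth j (· * ·) fun i => g i.succ) := by
  ext i
  refine Fin.cases ?_ (fun i => ?_) i <;> simp [Fin.contractNth]

lemma barD_ofFn (n : ℕ) (F : List G → ℤ) (g : Fin (n + 1) → G) :
    barD F (List.ofFn g) = F (List.ofFn fun i => g i.succ) +
      ∑ j : Fin (n + 1), (-1) ^ ((j : ℕ) + 1) * F (List.ofFn (Fin.contractNth j (· * ·) g)) := by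
  induction n generalizing F with
  | zero => simp [barD]
  | succ n ih =>
    have h := ih (fun l => F (g 0 :: l)) fun i => g i.succ
    rw [List.ofFn_succ] at h
    rw [List.ofFn_succ, List.ofFn_succ, barD, h, Fin.sum_univ_succ (n := n + 1),
      contractNth_zero_mul]
    simp only [contractNth_succ_mul, List.ofFn_cons, Fin.val_succ, pow_succ _ (_ + 1)]
    simp
    ring

end BarComplex

section GroupCohomology

open CategoryTheory

variable {G : Type} [CommGroup G]

lemma inhomogeneousCochains_d_trivial_apply (n : ℕ) (F : List G → ℤ) (g : Fin (n + 1) → G) :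
    inhomogeneousCochains.d (Rep.trivial ℤ G ℤ) n (fun v => F (List.ofFn v)) g =
      barD F (List.ofFn g) := by
  rw [inhomogeneousCochains.d_hom_apply, barD_ofFn]
  rfl

lemma exists_barD_eq_of_subsingleton {n : ℕ}
    [Subsingleton (groupCohomology (Rep.trivial ℤ G ℤ) (n + 1))] {F : List G → ℤ}
    (hF : ∀ l, barD F l = 0) :
    ∃ F' : List G → ℤ, ∀ l : List G, l.length = n + 1 → F l = barD F' l := by
  have hz : Limits.IsZero ((groupCohomology.inhomogeneousCochains
      (Rep.trivial ℤ G ℤ)).homology (n + 1)) :=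
    ModuleCat.isZero_of_subsingleton (groupCohomology (Rep.trivial ℤ G ℤ) (n + 1))
  rw [← HomologicalComplex.exactAt_iff_isZero_homology,
    HomologicalComplex.exactAt_iff' _ n (n + 1) (n + 2) (by simp) (by simp),
    ShortComplex.moduleCat_exact_iff] at hz
  obtain ⟨u, hu⟩ := hz (fun v => F (List.ofFn v)) (by
    change ((groupCohomology.inhomogeneousCochains (Rep.trivial ℤ G ℤ)).d (n + 1) (n + 1 + 1))
      (fun v => F (List.ofFn v)) = 0
    rw [groupCohomology.inhomogeneousCochains.d_def]
    ext g
    rw [inhomogeneousCochains_d_trivial_apply, hF]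
    rfl)
  change ((groupCohomology.inhomogeneousCochains (Rep.trivial ℤ G ℤ)).d n (n + 1)) u = _ at hu
  rw [groupCohomology.inhomogeneousCochains.d_def] at hu
  change (Fin n → G) → ℤ at u
  let F' : List G → ℤ := fun l => if h : l.length = n then u fun i => l.get (i.cast h.symm) else 0
  have hF' : (fun v : Fin n → G => F' (List.ofFn v)) = u := by
    ext v
    simp [F']
  refine ⟨F', fun l hl => ?_⟩
  obtain ⟨g, rfl⟩ : ∃ g : Fin (n + 1) → G, List.ofFn g = l :=
    hl ▸ ⟨l.get, List.ofFn_get l⟩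
  rw [← inhomogeneousCochains_d_trivial_apply, hF', hu]

lemma subsingleton_groupCohomology_one_trivial [Finite G] :
    Subsingleton (groupCohomology (Rep.trivial ℤ G ℤ) 1) := by
  have : Subsingleton (Additive G →+ ℤ) := by
    refine subsingleton_of_forall_eq 0 fun f => AddMonoidHom.ext fun a => ?_
    have h : Nat.card (Additive G) • f a = 0 := by
      rw [← map_nsmul, card_nsmul_eq_zero', map_zero]
    exact (smul_eq_zero.mp h).resolve_left Nat.card_pos.ne'
  exact (groupCohomology.H1IsoOfIsTrivial
    (Rep.trivial ℤ G ℤ)).toLinearEquiv.toEquiv.subsingleton_congr.mpr this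

end GroupCohomology

/-- The carry of the addition of the standard representatives of two residues modulo `p`. -/
def carry (p : ℕ) (a b : ZMod p) : ℤ := ((a.val + b.val) / p : ℕ)

lemma val_sub_val_add_eq_carry {p : ℕ} [NeZero p] (a b : ZMod p) :
    (b.val : ℤ) - (a + b).val + a.val = p * carry p a b := by
  have h := Nat.mod_add_div (a.val + b.val) p
  rw [← ZMod.val_add] at h
  unfold carry
  zify at h ⊢
  linarith

lemma carry_zero_left {p : ℕ} [NeZero p] (b : ZMod p) : carry p 0 b = 0 := by
  simp [carry, Nat.div_eq_of_lt b.val_lt]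

lemma carry_zero_right {p : ℕ} [NeZero p] (b : ZMod p) : carry p b 0 = 0 := by
  simp [carry, Nat.div_eq_of_lt b.val_lt]

lemma sum_carry_one {p : ℕ} [Fact p.Prime] : ∑ i, carry p 1 i = 1 := by
  have hp : (p : ℤ) ≠ 0 := mod_cast (Fact.out : p.Prime).ne_zero
  apply mul_left_cancel₀ hp
  rw [Finset.mul_sum]
  simp only [← val_sub_val_add_eq_carry, Finset.sum_add_distrib, Finset.sum_sub_distrib]
  have h := Equiv.sum_comp (Equiv.addLeft (1 : ZMod p)) fun i => (i.val : ℤ)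
  rw [Equiv.coe_addLeft] at h
  rw [h, ZMod.val_one]
  simp

/-- The odd integral cohomology of `C_p × C_p` is nonzero from degree three on. -/
lemma not_subsingleton_groupCohomology_CpCp (p : ℕ) [Fact p.Prime] (k : ℕ) :
    ¬ Subsingleton (groupCohomology
      (Rep.trivial ℤ (Multiplicative (ZMod p × ZMod p)) ℤ) (2 * k + 3)) := by
  intro hsub
  have hp : (p : ℤ) ≠ 0 := mod_cast (Fact.out : p.Prime).ne_zero
  let x₁ : Multiplicative (ZMod p × ZMod p) → ℤ := fun a => a.toAdd.1.val
  let x₂ : Multiplicative (ZMod p × ZMod p) → ℤ := fun a => a.toAdd.2.val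
  let y₁ : Multiplicative (ZMod p × ZMod p) → Multiplicative (ZMod p × ZMod p) → ℤ :=
    fun a b => carry p a.toAdd.1 b.toAdd.1
  let y₂ : Multiplicative (ZMod p × ZMod p) → Multiplicative (ZMod p × ZMod p) → ℤ :=
    fun a b => carry p a.toAdd.2 b.toAdd.2
  let g : Multiplicative (ZMod p × ZMod p) := .ofAdd (1, 0)
  let s : ZMod p → Multiplicative (ZMod p × ZMod p) := fun i => .ofAdd (0, i)
  obtain ⟨F, hF⟩ := exists_barD_eq_of_subsingleton (n := 2 * k + 2)
    (barD_oddCochain (x₁ := x₁) (x₂ := x₂) (y₁ := y₁) (y₂ := y₂) hp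
      (fun _ _ => val_sub_val_add_eq_carry _ _) (fun _ _ => val_sub_val_add_eq_carry _ _) k)
  have h₁ := periodicSum_slant_oddCochain g (s 1) s (x₁ := x₁) (x₂ := x₂) (y₁ := y₁) (y₂ := y₂)
    (congrArg Nat.cast (ZMod.val_one p)) (by simp [x₁, s])
    (fun _ => carry_zero_left _) (carry_zero_right _) (carry_zero_left _)
    (fun _ => carry_zero_left _) (carry_zero_right _) sum_carry_one k
  have h₂ := periodicSum_congr (s 1) s (m := p) (k + 1) (fun l hl _ =>
    (congrArg (· % (p : ℤ)) ((slant_congr g hF l (hl.trans (by ring))).trans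
      (slant_barD g F l)) : _ ≡ _ [ZMOD p]))
  have h₃ := periodicSum_barD (s 1) s (Equiv.addLeft 1)
    (fun i => by simp [s, ← ofAdd_add]) (k + 1) (fun l => -1 * slant g F l)
  rw [funext (barD_const_mul (-1) (slant g F)), ZMod.card] at h₃
  simp only [neg_one_mul] at h₃
  have h₄ := h₂.trans h₃
  rw [h₁, Int.modEq_zero_iff_dvd] at h₄
  exact (Nat.prime_iff_prime_int.mp Fact.out).not_isUnit (isUnit_of_dvd_unit h₄ (by simp))

/-- The integral group cohomology of `C_p × C_p` in positive degrees is not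
periodic of any period `d ≥ 1`. -/
theorem groupCohomology_CpCp_not_periodic (p : ℕ) (hp : p.Prime) (d : ℕ) (hd : 1 ≤ d) :
    ¬ (∀ n : ℕ, 1 ≤ n →
      Nonempty
        ((groupCohomology (Rep.trivial ℤ (Multiplicative (ZMod p × ZMod p)) ℤ) n) ≃ₗ[ℤ]
          (groupCohomology (Rep.trivial ℤ (Multiplicative (ZMod p × ZMod p)) ℤ) (n + d)))) := by
  intro h
  have : Fact p.Prime := ⟨hp⟩
  obtain ⟨e₁⟩ := h 1 le_rfl
  obtain ⟨e₂⟩ := h (1 + d) (by omega)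
  obtain ⟨k, rfl⟩ : ∃ k, d = k + 1 := ⟨d - 1, by omega⟩
  apply not_subsingleton_groupCohomology_CpCp p k
  have hdeg : 2 * k + 3 = 1 + (k + 1) + (k + 1) := by ring
  rw [hdeg, ← (e₁.trans e₂).toEquiv.subsingleton_congr]
  have : Finite (Multiplicative (ZMod p × ZMod p)) :=
    inferInstanceAs (Finite (ZMod p × ZMod p))
  exact subsingleton_groupCohomology_one_trivial
end

section
/- Let p be a prime, and let A be a (possibly noncommutative) ring which is an algebra over the p-adic integers ℤ_p and is finitely generated as a ℤ_p-module. Let v ≥ 1 and let ε ∈ A satisfy ε² − ε ∈ p^v·A. Then there exists an idempotent e ∈ A (i.e. e² = e) with e − ε ∈ p^v·A. -/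
/-- A finite module over a precomplete ring is precomplete. -/
theorem IsPrecomplete.of_moduleFinite {R : Type*} [CommRing R] (I : Ideal R) [IsPrecomplete I R]
    (M : Type*) [AddCommGroup M] [Module R M] [Module.Finite R M] : IsPrecomplete I M := by
  rw [← AdicCompletion.of_surjective_iff]
  intro y
  obtain ⟨t, rfl⟩ := AdicCompletion.ofTensorProduct_surjective_of_finite I M y
  induction t with
  | zero => exact ⟨0, by simp⟩
  | add s t hs ht =>
    obtain ⟨a, ha⟩ := hs
    obtain ⟨b, hb⟩ := ht
    exact ⟨a + b, by rw [map_add, map_add, ha, hb]⟩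
  | tmul r m =>
    obtain ⟨s, rfl⟩ := AdicCompletion.of_surjective I R r
    refine ⟨s • m, ?_⟩
    rw [AdicCompletion.ofTensorProduct_tmul, map_smul]
    exact (algebraMap_smul (AdicCompletion I R) s (AdicCompletion.of I M m)).symm

theorem Submodule.mem_span_singleton_pow_smul_top_iff_dvd {R A : Type*} [CommRing R] [Ring A]
    [Algebra R A] (r : R) (n : ℕ) (x : A) :
    x ∈ (Ideal.span {r} ^ n • ⊤ : Submodule R A) ↔ algebraMap R A r ^ n ∣ x := by
  rw [Ideal.span_singleton_pow, Submodule.ideal_span_singleton_smul,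
    Submodule.mem_smul_pointwise_iff_exists]
  simp [dvd_def, Algebra.smul_def, eq_comm]

theorem dvd_mul_of_commute {A : Type*} [Monoid A] {q x : A} (a : A) (hq : Commute q a)
    (hx : q ∣ x) : q ∣ a * x := by
  obtain ⟨c, rfl⟩ := hx
  exact ⟨a * c, by rw [← mul_assoc, ← hq.eq, mul_assoc]⟩

/-- Idempotents modulo `r ^ v` lift to an algebra that is `r`-adically complete as a module. -/
theorem exists_isIdempotentElem_of_isAdicComplete {R A : Type*} [CommRing R] [Ring A]
    [Algebra R A] (r : R) [IsAdicComplete (Ideal.span {r}) A] {v : ℕ} (hv : 1 ≤ v) {ε : A}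
    (h : algebraMap R A r ^ v ∣ ε ^ 2 - ε) :
    ∃ e : A, IsIdempotentElem e ∧ algebraMap R A r ^ v ∣ e - ε := by
  set q := algebraMap R A r
  have hq (n : ℕ) (a : A) : Commute (q ^ n) a := Commute.pow_left (Algebra.commutes r a) n
  let f (n : ℕ) : A := (fun x : A => 3 * x ^ 2 - 2 * x ^ 3)^[n] ε
  have hf (n : ℕ) : f (n + 1) = 3 * f n ^ 2 - 2 * f n ^ 3 := Function.iterate_succ_apply' ..
  have defect (n : ℕ) : q ^ (n + v) ∣ f n ^ 2 - f n := by
    induction n with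
    | zero => simpa [f] using h
    | succ n ih =>
      have key : f (n + 1) ^ 2 - f (n + 1) =
          (f n ^ 2 - f n) * (f n ^ 2 - f n) * (4 * (f n ^ 2 - f n) - 3) := by
        rw [hf]
        noncomm_ring
      rw [key]
      obtain ⟨c, hc⟩ := ih
      refine Dvd.dvd.mul_right ((pow_dvd_pow q (by lia : n + 1 + v ≤ (n + v) + (n + v))).trans
        ⟨c * c, ?_⟩) _
      rw [hc, (hq _ c).symm.mul_mul_mul_comm, ← pow_add]
  have step (n : ℕ) : q ^ (n + v) ∣ f (n + 1) - f n := by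
    have key : f (n + 1) - f n = (f n ^ 2 - f n) * (1 - 2 * f n) := by
      rw [hf]
      noncomm_ring
    exact key ▸ (defect n).mul_right _
  have cauchy {m n : ℕ} (hmn : m ≤ n) : q ^ (m + v) ∣ f n - f m := by
    induction n, hmn using Nat.le_induction with
    | base => simp
    | succ n hmn ih =>
      rw [← sub_add_sub_cancel (f (n + 1)) (f n)]
      exact dvd_add ((pow_dvd_pow q (by lia)).trans (step n)) ih
  have smodEq_iff (n : ℕ) (x y : A) :
      x ≡ y [SMOD (Ideal.span {r} ^ n • ⊤ : Submodule R A)] ↔ q ^ n ∣ x - y := by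
    rw [SModEq.sub_mem, Submodule.mem_span_singleton_pow_smul_top_iff_dvd]
  obtain ⟨e, he⟩ := IsPrecomplete.prec' (I := Ideal.span {r}) f fun {m n} hmn =>
    ((smodEq_iff m _ _).2 ((pow_dvd_pow q (by lia)).trans (cauchy hmn))).symm
  replace he (n : ℕ) : q ^ n ∣ e - f n := (smodEq_iff n _ _).1 (he n).symm
  refine ⟨e, ?_, ?_⟩
  · rw [IsIdempotentElem, IsHausdorff.eq_iff_smodEq (I := Ideal.span {r})]
    intro n
    rw [smodEq_iff]
    have key : e * e - e =
        f n ^ 2 - f n + (e - f n) * e + f n * (e - f n) - (e - f n) := by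
      noncomm_ring
    rw [key]
    exact dvd_sub (dvd_add (dvd_add ((pow_dvd_pow q (by lia)).trans (defect n))
      ((he n).mul_right _)) (dvd_mul_of_commute _ (hq n _) (he n))) (he n)
  · rw [← sub_add_sub_cancel e (f v)]
    exact dvd_add (he v) ((pow_dvd_pow q (by lia)).trans (cauchy (Nat.zero_le v)))


/-- Idempotent lifting in a ring that is a finitely generated algebra (as module)
over the `p`-adic integers: an element idempotent modulo `p^v` differs from a
genuine idempotent by an element of `p^v·A`. -/
theorem idempotent_lift_padic (p : ℕ) [Fact p.Prime] (A : Type*) [Ring A]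
    [Algebra (PadicInt p) A] [Module.Finite (PadicInt p) A]
    (v : ℕ) (hv : 1 ≤ v) (ε : A) (h : ∃ a : A, ε ^ 2 - ε = p ^ v • a) :
    ∃ e : A, e ^ 2 = e ∧ ∃ a : A, e - ε = p ^ v • a := by
  have hspan := PadicInt.maximalIdeal_eq_span_p (p := p)
  have : IsPrecomplete (Ideal.span {(p : ℤ_[p])}) A :=
    hspan ▸ IsPrecomplete.of_moduleFinite (IsLocalRing.maximalIdeal ℤ_[p]) A
  have : IsHausdorff (Ideal.span {(p : ℤ_[p])}) A :=
    hspan ▸ (inferInstance : IsHausdorff (IsLocalRing.maximalIdeal ℤ_[p]) A)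
  have : IsAdicComplete (Ideal.span {(p : ℤ_[p])}) A := {}
  have dvd_iff (x : A) :
      algebraMap ℤ_[p] A p ^ v ∣ x ↔ ∃ a : A, x = p ^ v • a := by
    simp [dvd_def, nsmul_eq_mul]
  obtain ⟨e, he, hd⟩ :=
    exists_isIdempotentElem_of_isAdicComplete (p : ℤ_[p]) hv ((dvd_iff _).2 h)
  exact ⟨e, by rw [pow_two, he.eq], (dvd_iff _).1 hd⟩
end
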